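/- Let R be a commutative ring and (A, D_G) a 1-tilting cotorsion pair with associated Gabriel topology G. If A is a covering class, then G is a perfect Gabriel topology, i.e. ψ_R : R → R_G is a flat ring epimorphism and G = {J ≤ R : J R_G = R_G}. -/

import Mathlib

universe u

/-- A Gabriel topology on a commutative ring `R`: a filter of ideals of `R`
satisfying the Gabriel axiom T4. -/
structure GabrielTopology (R : Type u) [CommRing R] : Type u where
  sets : Set (Ideal R)
  top_mem : (⊤ : Ideal R) ∈ sets
  mem_of_le : ∀ {I J : Ideal R}, I ∈ sets → I ≤ J → J ∈ sets
  inf_mem : ∀ {I J : Ideal R}, I ∈ sets → J ∈ sets → I ⊓ J ∈ sets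
  gabriel : ∀ I J : Ideal R, J ∈ sets →
    (∀ r ∈ J, Submodule.colon I (Ideal.span {r}) ∈ sets) → I ∈ sets

namespace GabrielTopology

variable {R : Type u} [CommRing R] (G : GabrielTopology R)

/-- A module `M` is `G`-torsion if the annihilator of every element belongs to `G`. -/
def IsTorsion (M : Type u) [AddCommGroup M] [Module R M] : Prop :=
  ∀ x : M, Ideal.torsionOf R M x ∈ G.sets

/-- A module `M` is `G`-torsion-free if no nonzero element is annihilated by an ideal of `G`. -/
def IsTorsionFree (M : Type u) [AddCommGroup M] [Module R M] : Prop :=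
  ∀ x : M, Ideal.torsionOf R M x ∈ G.sets → x = 0

/-- A module `M` is `G`-divisible if `JM = M` for every `J ∈ G`. -/
def IsDivisible (M : Type u) [AddCommGroup M] [Module R M] : Prop :=
  ∀ J ∈ G.sets, J • (⊤ : Submodule R M) = ⊤

/-- `G` is faithful if `R` is `G`-torsion-free. -/
def Faithful : Prop := ∀ r : R, Ideal.torsionOf R R r ∈ G.sets → r = 0

/-- `G` is finitely generated if it has a basis of finitely generated ideals. -/
def FinitelyGenerated : Prop := ∀ J ∈ G.sets, ∃ J' ∈ G.sets, J' ≤ J ∧ J'.FG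

end GabrielTopology

/-- `Ext¹_R(M, N) = 0`, expressed by the standard characterisation:
every short exact sequence `0 → N → E → M → 0` splits. -/
def Ext1Vanish (R : Type u) [CommRing R] (M N : Type u) [AddCommGroup M] [Module R M]
    [AddCommGroup N] [Module R N] : Prop :=
  ∀ (E : Type u) [AddCommGroup E] [Module R E] (i : N →ₗ[R] E) (p : E →ₗ[R] M),
    Function.Injective i → Function.Surjective p → LinearMap.range i = LinearMap.ker p →
      ∃ s : M →ₗ[R] E, p ∘ₗ s = LinearMap.id

/-- `M` has projective dimension at most 1: the kernel of a free cover is projective. -/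
def ProjDimLE1 (R : Type u) [CommRing R] (M : Type u) [AddCommGroup M] [Module R M] : Prop :=
  ∃ (ι : Type u) (p : (ι →₀ R) →ₗ[R] M),
    Function.Surjective p ∧ Module.Projective R ↥(LinearMap.ker p)

/-- `M ∈ Add(T)`: `M` is a direct summand of a direct sum of copies of `T`. -/
def InAdd (R : Type u) [CommRing R] (T M : Type u) [AddCommGroup T] [Module R T]
    [AddCommGroup M] [Module R M] : Prop :=
  ∃ (ι : Type u) (s : M →ₗ[R] (ι →₀ T)) (r : (ι →₀ T) →ₗ[R] M), r ∘ₗ s = LinearMap.id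

/-- `T` is a 1-tilting module: (T1) `p.dim T ≤ 1`, (T2) `Ext¹(T, T^(κ)) = 0` for all κ,
(T3) there is an exact sequence `0 → R → T₀ → T₁ → 0` with `T₀, T₁ ∈ Add(T)`. -/
def Is1Tilting (R : Type u) [CommRing R] (T : Type u) [AddCommGroup T] [Module R T] : Prop :=
  ProjDimLE1 R T ∧
  (∀ ι : Type u, Ext1Vanish R T (ι →₀ T)) ∧
  ∃ (T0 T1 : ModuleCat.{u} R) (i : R →ₗ[R] ↥T0) (p : ↥T0 →ₗ[R] ↥T1),
    InAdd R T ↥T0 ∧ InAdd R T ↥T1 ∧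
    Function.Injective i ∧ Function.Surjective p ∧ LinearMap.range i = LinearMap.ker p

namespace GabrielTopology

variable {R : Type u} [CommRing R] (G : GabrielTopology R)

/-- `(𝒜, 𝒟_G)` is a 1-tilting cotorsion pair with associated Gabriel topology `G`:
`G` is a faithful finitely generated Gabriel topology and the class of `G`-divisible
modules is the tilting class of a 1-tilting module. -/
def IsTiltingTopology : Prop :=
  G.Faithful ∧ G.FinitelyGenerated ∧
  ∃ T : ModuleCat.{u} R, Is1Tilting R ↥T ∧
    ∀ (M : Type u) [AddCommGroup M] [Module R M], (Ext1Vanish R ↥T M ↔ G.IsDivisible M)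

/-- Membership in the left-hand class `𝒜 = ᗮ(𝒟_G)` of the 1-tilting cotorsion pair. -/
def MemA (M : Type u) [AddCommGroup M] [Module R M] : Prop :=
  ∀ (D : Type u) [AddCommGroup D] [Module R D], G.IsDivisible D → Ext1Vanish R M D

/-- The class `𝒜` is covering: every module has an `𝒜`-cover. -/
def IsACovering : Prop :=
  ∀ (M : Type u) [AddCommGroup M] [Module R M],
    ∃ (C : ModuleCat.{u} R) (φ : ↥C →ₗ[R] M),
      G.MemA ↥C ∧
      (∀ (C' : Type u) [AddCommGroup C'] [Module R C'], G.MemA C' →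
        ∀ f : C' →ₗ[R] M, ∃ g : C' →ₗ[R] ↥C, φ ∘ₗ g = f) ∧
      (∀ e : ↥C →ₗ[R] ↥C, φ ∘ₗ e = φ → Function.Bijective e)

/-- The class `𝒜` is closed under direct limits. -/
def AClosedUnderDirectLimits : Prop :=
  ∀ (ι : Type u) [Preorder ι] [IsDirected ι (· ≤ ·)] [Nonempty ι] [DecidableEq ι]
    (M : ι → Type u) [∀ i, AddCommGroup (M i)] [∀ i, Module R (M i)]
    (f : ∀ i j, i ≤ j → M i →ₗ[R] M j) [DirectedSystem M fun i j h => f i j h],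
    (∀ i, G.MemA (M i)) → G.MemA (Module.DirectLimit M f)

/-- `Q`, via `algebraMap R Q`, is the ring of quotients `R_G` of `R` with respect to `G`:
`Q` is `G`-torsion-free and `G`-injective (i.e. `G`-closed) and the kernel and cokernel
of `R → Q` are `G`-torsion. -/
structure IsRingOfQuotients (Q : Type u) [CommRing Q] [Algebra R Q] : Prop where
  torsionFree : ∀ q : Q, Ideal.torsionOf R Q q ∈ G.sets → q = 0
  gInjective : ∀ J ∈ G.sets, ∀ f : ↥J →ₗ[R] Q, ∃ q : Q, ∀ j : ↥J, f j = (j : R) • q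
  ker_torsion : ∀ r : R, algebraMap R Q r = 0 → Ideal.torsionOf R R r ∈ G.sets
  coker_torsion : ∀ q : Q, ∃ J ∈ G.sets, ∀ x ∈ J, ∃ r : R, x • q = algebraMap R Q r

/-- `G` is a perfect Gabriel topology, realised by the perfect localisation `Q`:
`R → Q` is a flat ring epimorphism and `G = {J ∣ JQ = Q}`. -/
def IsPerfectLocalization (Q : Type u) [CommRing Q] [Algebra R Q] : Prop :=
  Module.Flat R Q ∧
  (∀ (S : Type u) [CommRing S] (f g : Q →+* S),
    f.comp (algebraMap R Q) = g.comp (algebraMap R Q) → f = g) ∧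
  (∀ J : Ideal R, J ∈ G.sets ↔ J • (⊤ : Submodule R Q) = ⊤)

end GabrielTopology

/-- A commutative ring is perfect iff every flat module is projective. -/
def IsPerfectRing (S : Type u) [CommRing S] : Prop :=
  ∀ (M : Type u) [AddCommGroup M] [Module S M], Module.Flat S M → Module.Projective S M

/-- `X` is Σ-pure-split: every pure embedding `A ⊆ B` with `B ∈ Add(X)` splits. -/
def SigmaPureSplit (R : Type u) [CommRing R] (X : Type u) [AddCommGroup X] [Module R X] : Prop :=
  ∀ (A B : Type u) [AddCommGroup A] [Module R A] [AddCommGroup B] [Module R B] (i : A →ₗ[R] B),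
    Function.Injective i →
    (∀ (M : Type u) [AddCommGroup M] [Module R M], Function.Injective (LinearMap.rTensor M i)) →
    InAdd R X B → ∃ r : B →ₗ[R] A, r ∘ₗ i = LinearMap.id

/-- A concrete model of `Ext¹_R(M, N)`, computed from the canonical free presentation
`0 → S → (M →₀ R) → M → 0` of `M` as `coker (Hom((M →₀ R), N) → Hom(S, N))`. -/
abbrev ext1 (R : Type u) [CommRing R] (M N : Type u) [AddCommGroup M] [Module R M]
    [AddCommGroup N] [Module R N] : Type u :=
  (↥(LinearMap.ker (Finsupp.linearCombination R (id : M → M))) →ₗ[R] N) ⧸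
    LinearMap.range
      (LinearMap.lcomp R N (LinearMap.ker (Finsupp.linearCombination R (id : M → M))).subtype)

/-- A concrete model of `Tor₁^R(M, N)`, computed from the canonical free presentation
`0 → S → (M →₀ R) → M → 0` of `M` as `ker (S ⊗ N → (M →₀ R) ⊗ N)`. -/
abbrev tor1 (R : Type u) [CommRing R] (M N : Type u) [AddCommGroup M] [Module R M]
    [AddCommGroup N] [Module R N] : Type u :=
  ↥(LinearMap.ker
    (LinearMap.rTensor N (LinearMap.ker (Finsupp.linearCombination R (id : M → M))).subtype))

/-- The cokernel `U/R` of a ring map `R → U`. -/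
abbrev cokerAlg (R U : Type u) [CommRing R] [CommRing U] [Algebra R U] : Type u :=
  U ⧸ LinearMap.range (Algebra.linearMap R U)

/-- A linear topology on a commutative ring `R`, given by its filter of open ideals. -/
structure LinearTopologyOn (R : Type u) [CommRing R] : Type u where
  sets : Set (Ideal R)
  top_mem : (⊤ : Ideal R) ∈ sets
  mem_of_le : ∀ {I J : Ideal R}, I ∈ sets → I ≤ J → J ∈ sets
  inf_mem : ∀ {I J : Ideal R}, I ∈ sets → J ∈ sets → I ⊓ J ∈ sets

/-- An `R`-module `M` is `H`-discrete if the annihilator of every element is open. -/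
def LinearTopologyOn.IsDiscrete {R : Type u} [CommRing R] (H : LinearTopologyOn R)
    (M : Type u) [AddCommGroup M] [Module R M] : Prop :=
  ∀ x : M, Ideal.torsionOf R M x ∈ H.sets

/-- `R` is `H`-h-local: every open ideal is contained in only finitely many maximal ideals,
and every open prime ideal is contained in only one maximal ideal. -/
def LinearTopologyOn.IsHLocal {R : Type u} [CommRing R] (H : LinearTopologyOn R) : Prop :=
  (∀ J ∈ H.sets, {m : Ideal R | m.IsMaximal ∧ J ≤ m}.Finite) ∧
  (∀ p ∈ H.sets, p.IsPrime →
    ∀ m n : Ideal R, m.IsMaximal → n.IsMaximal → p ≤ m → p ≤ n → m = n)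

/-- Over `S`, `M` admits a resolution of length `n` by finitely generated projectives. -/
def FGProjDimLE (S : Type u) [CommRing S] :
    ℕ → ∀ (M : Type u) [AddCommGroup M] [Module S M], Prop
  | 0, M, iA, iM =>
      letI := iA; letI := iM
      Module.Finite S M ∧ Module.Projective S M
  | n + 1, M, iA, iM =>
      letI := iA; letI := iM
      ∃ (k : ℕ) (f : (Fin k → S) →ₗ[S] M),
        Function.Surjective f ∧ FGProjDimLE S n ↥(LinearMap.ker f)

open Finset in
/-- Membership in `JM` when `J` is generated by a finite family. -/
theorem Ideal.mem_span_range_smul_top_iff {R : Type*} [CommRing R] {M : Type*} [AddCommGroup M]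
    [Module R M] {n : ℕ} (a : Fin n → R) (x : M) :
    x ∈ Ideal.span (Set.range a) • (⊤ : Submodule R M) ↔ ∃ m : Fin n → M, ∑ i, a i • m i = x := by
  constructor
  · intro hx
    refine Submodule.smul_induction_on hx (fun r hr y _ => ?_) ?_
    · obtain ⟨c, rfl⟩ := (Ideal.mem_span_range_iff_exists_fun).1 hr
      exact ⟨fun i => c i • y, by simp [sum_smul, smul_smul, mul_comm]⟩
    · rintro y z ⟨m, rfl⟩ ⟨m', rfl⟩
      exact ⟨m + m', by simp [sum_add_distrib]⟩
  · rintro ⟨m, rfl⟩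
    exact Submodule.sum_mem _ fun i _ =>
      Submodule.smul_mem_smul (Ideal.subset_span ⟨i, rfl⟩) trivial

/-- Every module embeds into an injective module. -/
theorem Module.exists_injective_embedding (R : Type u) [CommRing R] (M : Type u) [AddCommGroup M]
    [Module R M] : ∃ (I : ModuleCat.{u} R) (i : M →ₗ[R] I), Module.Injective R I ∧
      Function.Injective i := by
  obtain ⟨⟨I, hI, f, hf⟩⟩ :=
    CategoryTheory.EnoughInjectives.presentation (ModuleCat.of R M)
  exact ⟨I, f.hom, Module.injective_module_of_injective_object R I,
    (ModuleCat.mono_iff_injective f).1 hf⟩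

/-- If `x i = ∑ j ∈ s, e i j (x j)` for endomorphisms `e i j` killed by `φ`, and `φ` is such that
all endomorphisms `e` with `φ e = φ` are bijective, then all `x i` vanish. -/
theorem LinearMap.eq_zero_of_eq_sum_of_comp_eq_zero {R : Type*} [CommRing R] {A M : Type*}
    [AddCommGroup A] [Module R A] [AddCommGroup M] [Module R M] (φ : A →ₗ[R] M)
    (hφ : ∀ e : A →ₗ[R] A, φ ∘ₗ e = φ → Function.Bijective e) {ι : Type*}
    (s : Finset ι) (x : ι → A) (e : ι → ι → A →ₗ[R] A) (he : ∀ i j y, φ (e i j y) = 0)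
    (hx : ∀ i ∈ s, x i = ∑ j ∈ s, e i j (x j)) : ∀ i ∈ s, x i = 0 := by
  classical
  induction s using Finset.induction_on generalizing e with
  | empty => simp
  | insert k s hk ih =>
    have hb : Function.Bijective (LinearMap.id - e k k : A →ₗ[R] A) :=
      hφ _ (LinearMap.ext fun y => by simp [he])
    let u := LinearEquiv.ofBijective _ hb
    have hxk : x k = u.symm (∑ j ∈ s, e k j (x j)) := by
      rw [LinearEquiv.eq_symm_apply]
      have h := hx k (Finset.mem_insert_self _ _)
      rw [Finset.sum_insert hk] at h
      change x k - e k k (x k) = _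
      rw [sub_eq_iff_eq_add', ← h]
    have h0 : ∀ i ∈ s, x i = 0 := by
      refine ih (fun i j => e i j + e i k ∘ₗ u.symm.toLinearMap ∘ₗ e k j)
        (fun i j y => by simp [he]) fun i hi => ?_
      have h := hx i (Finset.mem_insert_of_mem hi)
      rw [Finset.sum_insert hk] at h
      rw [h, hxk]
      simp [Finset.sum_add_distrib, map_sum, add_comm]
    intro i hi
    obtain rfl | hi := Finset.mem_insert.1 hi
    · rw [hxk, Finset.sum_eq_zero fun j hj => by rw [h0 j hj, map_zero], map_zero]
    · exact h0 i hi

namespace GabrielTopology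

variable {R : Type u} [CommRing R] {G : GabrielTopology R}

theorem isDivisible_of_forall_fin (hfg : G.FinitelyGenerated) {M : Type u} [AddCommGroup M]
    [Module R M] (h : ∀ (n : ℕ) (a : Fin n → R), Ideal.span (Set.range a) ∈ G.sets →
      ∀ x : M, ∃ m : Fin n → M, ∑ i, a i • m i = x) : G.IsDivisible M := by
  intro J hJ
  obtain ⟨J', hJ', hle, hJfg⟩ := hfg J hJ
  obtain ⟨n, a, rfl⟩ := Submodule.fg_iff_exists_fin_generating_family.1 hJfg
  exact eq_top_iff.2 fun x _ => Submodule.smul_mono_left hle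
    ((Ideal.mem_span_range_smul_top_iff a x).2 (h n a hJ' x))

theorem IsDivisible.exists_sum_eq {M : Type u} [AddCommGroup M] [Module R M]
    (hM : G.IsDivisible M) {n : ℕ} {a : Fin n → R} (ha : Ideal.span (Set.range a) ∈ G.sets)
    (x : M) : ∃ m : Fin n → M, ∑ i, a i • m i = x :=
  (Ideal.mem_span_range_smul_top_iff a x).1 (by rw [hM _ ha]; trivial)

theorem IsDivisible.of_surjective {M N : Type u} [AddCommGroup M] [Module R M] [AddCommGroup N]
    [Module R N] (hM : G.IsDivisible M) (f : M →ₗ[R] N) (hf : Function.Surjective f) :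
    G.IsDivisible N := by
  intro J hJ
  have h := congrArg (Submodule.map f) (hM J hJ)
  rwa [Submodule.map_smul'', Submodule.map_top, LinearMap.range_eq_top.2 hf] at h

theorem Faithful.isDivisible_of_injective (hf : G.Faithful) (hfg : G.FinitelyGenerated)
    (I : Type u) [AddCommGroup I] [Module R I] (hI : Module.Injective R I) : G.IsDivisible I := by
  refine isDivisible_of_forall_fin hfg fun n a ha x => ?_
  have hinj : Function.Injective (LinearMap.toSpanSingleton R (Fin n → R) a) := by
    rw [injective_iff_map_eq_zero]
    intro r hr
    refine hf r (G.mem_of_le ha (Ideal.span_le.2 ?_))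
    rintro _ ⟨i, rfl⟩
    simpa [mul_comm] using congrFun hr i
  obtain ⟨g, hg⟩ := hI.out _ hinj (LinearMap.toSpanSingleton R I x)
  refine ⟨fun i => g (Pi.single i 1), ?_⟩
  have h1 := hg 1
  simp only [LinearMap.toSpanSingleton_apply, one_smul] at h1
  rw [← h1]
  conv_rhs => rw [pi_eq_sum_univ' a]
  simp [map_sum]

/-- Modules in `𝒜` have the lifting property against surjections with divisible kernel. -/
theorem MemA.exists_lift {C : Type u} [AddCommGroup C] [Module R C] (hC : G.MemA C)
    {E F : Type u} [AddCommGroup E] [Module R E] [AddCommGroup F] [Module R F] (p : E →ₗ[R] F)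
    (hp : Function.Surjective p) (hker : G.IsDivisible (LinearMap.ker p)) (f : C →ₗ[R] F) :
    ∃ s : C →ₗ[R] E, p ∘ₗ s = f := by
  let X : Submodule R (E × C) :=
    LinearMap.eqLocus (p ∘ₗ LinearMap.fst R E C) (f ∘ₗ LinearMap.snd R E C)
  let i : LinearMap.ker p →ₗ[R] X :=
    LinearMap.codRestrict X (LinearMap.inl R E C ∘ₗ (LinearMap.ker p).subtype)
      fun x => by simp [X, LinearMap.mem_eqLocus]
  let q : X →ₗ[R] C := LinearMap.snd R E C ∘ₗ X.subtype
  have hX : ∀ x : X, p x.1.1 = f x.1.2 := fun x => x.2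
  obtain ⟨s, hs⟩ := hC (LinearMap.ker p) hker X i q
    (fun x y hxy => Subtype.ext (congrArg (fun z : X => z.1.1) hxy))
    (fun c => by
      obtain ⟨e, he⟩ := hp (f c)
      exact ⟨⟨(e, c), he⟩, rfl⟩)
    (by
      ext x
      constructor
      · rintro ⟨y, rfl⟩
        rfl
      · intro hx
        have hx' : x.1.2 = 0 := hx
        exact ⟨⟨x.1.1, by simp [hX, hx']⟩, Subtype.ext (Prod.ext rfl hx'.symm)⟩)
  refine ⟨LinearMap.fst R E C ∘ₗ X.subtype ∘ₗ s, LinearMap.ext fun c => ?_⟩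
  exact (hX (s c)).trans (congrArg f (LinearMap.congr_fun hs c))

theorem memA_of_exists_lift {C : Type u} [AddCommGroup C] [Module R C]
    (h : ∀ (E F : Type u) [AddCommGroup E] [Module R E] [AddCommGroup F] [Module R F]
      (p : E →ₗ[R] F), Function.Surjective p → G.IsDivisible (LinearMap.ker p) →
      ∀ f : C →ₗ[R] F, ∃ s : C →ₗ[R] E, p ∘ₗ s = f) : G.MemA C := by
  intro D _ _ hD E _ _ i p _ hp hip
  refine h E C p hp ?_ LinearMap.id
  rw [← hip]
  exact hD.of_surjective i.rangeRestrict i.surjective_rangeRestrict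

theorem memA_of_projective (P : Type u) [AddCommGroup P] [Module R P] [Module.Projective R P] :
    G.MemA P :=
  memA_of_exists_lift fun _ _ _ _ _ _ p hp _ f => Module.projective_lifting_property p f hp

theorem MemA.finsupp {C : Type u} [AddCommGroup C] [Module R C] (hC : G.MemA C)
    (ι : Type) : G.MemA (ι →₀ C) := by
  refine memA_of_exists_lift fun E F _ _ _ _ p hp hker f => ?_
  choose s hs using fun i => hC.exists_lift p hp hker (f ∘ₗ Finsupp.lsingle i)
  refine ⟨Finsupp.lsum R s, ?_⟩
  ext i c
  simpa using LinearMap.congr_fun (hs i) c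

theorem mkQ_eq_sum_mkQ_single {C : Type u} [AddCommGroup C] [Module R C] {n : ℕ} (d : C)
    (a : Fin n → R) (N : Submodule R (C × (Fin n → R))) (hN : N = Submodule.span R {(d, -a)}) :
    N.mkQ (d, 0) = ∑ i, a i • N.mkQ (0, Pi.single i 1) := by
  have hsum : ∑ i, a i • (0, Pi.single i 1) = ((0, a) : C × (Fin n → R)) := by
    refine Prod.ext (by simp [Prod.fst_sum]) ?_
    ext j
    simp [Prod.snd_sum, Finset.sum_apply, Pi.single_apply]
  simp_rw [← map_smul, ← map_sum]
  rw [hsum, ← sub_eq_zero, ← map_sub, Submodule.mkQ_apply, Submodule.Quotient.mk_eq_zero, hN]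
  simp

theorem memA_pushout {C : Type u} [AddCommGroup C] [Module R C] (hC : G.MemA C) {n : ℕ}
    {a : Fin n → R} (ha : Ideal.span (Set.range a) ∈ G.sets) (d : C) :
    G.MemA ((C × (Fin n → R)) ⧸ Submodule.span R {((d, -a) : C × (Fin n → R))}) := by
  obtain ⟨N, hN⟩ : ∃ N, N = Submodule.span R {((d, -a) : C × (Fin n → R))} := ⟨_, rfl⟩
  rw [← hN]
  refine memA_of_exists_lift fun E F _ _ _ _ p hp hker f => ?_
  obtain ⟨s, hs⟩ := hC.exists_lift p hp hker (f ∘ₗ N.mkQ ∘ₗ LinearMap.inl R _ _)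
  choose y hy using fun i => hp (f (N.mkQ (0, Pi.single i 1)))
  have hda := mkQ_eq_sum_mkQ_single d a N hN
  have hmem : ∑ i, a i • y i - s d ∈ LinearMap.ker p := by
    have h1 : p (s d) = f (N.mkQ (d, 0)) := LinearMap.congr_fun hs d
    rw [LinearMap.mem_ker, map_sub, h1, hda]
    simp only [map_sum, map_smul, hy, sub_self]
  obtain ⟨k, hk⟩ := hker.exists_sum_eq ha ⟨_, hmem⟩
  have hk' : ∑ i, a i • (k i : E) = ∑ i, a i • y i - s d := by
    simpa using congrArg Subtype.val hk
  let t : (Fin n → R) →ₗ[R] E := Fintype.linearCombination R fun i => y i - k i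
  have ht : t a = s d := by
    simp [t, Fintype.linearCombination_apply, smul_sub, hk']
  refine ⟨N.liftQ (s.coprod t) ?_, ?_⟩
  · rw [hN, Submodule.span_singleton_le_iff_mem]
    simp [ht]
  · ext x
    · simpa using LinearMap.congr_fun hs x
    · have hk0 : p (k x) = 0 := (k x).2
      simp [t, hy, hk0, Fintype.linearCombination_apply_single]

/-- The kernel of an `𝒜`-cover is `G`-divisible. -/
theorem isDivisible_ker_of_cover (hfg : G.FinitelyGenerated) {C M : Type u} [AddCommGroup C]
    [Module R C] [AddCommGroup M] [Module R M] (hC : G.MemA C) (φ : C →ₗ[R] M)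
    (hpre : ∀ (C' : Type u) [AddCommGroup C'] [Module R C'], G.MemA C' →
        ∀ f : C' →ₗ[R] M, ∃ g : C' →ₗ[R] C, φ ∘ₗ g = f)
    (hcov : ∀ e : C →ₗ[R] C, φ ∘ₗ e = φ → Function.Bijective e) :
    G.IsDivisible (LinearMap.ker φ) := by
  refine isDivisible_of_forall_fin hfg fun n a ha ⟨d, hd⟩ => ?_
  have hd' : φ d = 0 := hd
  set N := Submodule.span R {((d, -a) : C × (Fin n → R))} with hN
  obtain ⟨g, hg⟩ := hpre _ (memA_pushout hC ha d) (N.liftQ (φ ∘ₗ LinearMap.fst R _ _) (by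
    rw [hN, Submodule.span_singleton_le_iff_mem]
    simp [hd']))
  have hg' : ∀ z, φ (g (N.mkQ z)) = φ z.1 := fun z => by
    simpa using LinearMap.congr_fun hg (N.mkQ z)
  let e : C →ₗ[R] C := g ∘ₗ N.mkQ ∘ₗ LinearMap.inl R _ _
  have he : φ ∘ₗ e = φ := LinearMap.ext fun x => hg' (x, 0)
  let u := LinearEquiv.ofBijective e (hcov e he)
  have hu : ∀ y, φ (u.symm y) = φ y := fun y => by
    conv_rhs => rw [← u.apply_symm_apply y]
    exact (LinearMap.congr_fun he (u.symm y)).symm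
  have hda := mkQ_eq_sum_mkQ_single d a N hN
  refine ⟨fun i => ⟨u.symm (g (N.mkQ (0, Pi.single i 1))), ?_⟩, Subtype.ext ?_⟩
  · rw [LinearMap.mem_ker, hu, hg', map_zero]
  · have hsum := u.symm_apply_apply d
    rw [show u d = g (N.mkQ (d, 0)) from rfl, hda] at hsum
    simpa only [map_sum, map_smul, AddSubmonoidClass.coe_finsetSum, Submodule.coe_smul] using hsum

theorem IsDivisible.ker_mapRange {C M : Type u} [AddCommGroup C]
    [Module R C] [AddCommGroup M] [Module R M] (φ : C →ₗ[R] M)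
    (h : G.IsDivisible (LinearMap.ker φ)) (ι : Type) :
    G.IsDivisible (LinearMap.ker (Finsupp.mapRange.linearMap φ : (ι →₀ C) →ₗ[R] (ι →₀ M))) := by
  intro J hJ
  rw [eq_top_iff]
  rintro x -
  rw [Submodule.mem_smul_top_iff]
  have hx : ∀ i, φ (x.1 i) = 0 := fun i => DFunLike.congr_fun (LinearMap.mem_ker.1 x.2) i
  rw [← Finsupp.sum_single x.1]
  refine Submodule.sum_mem _ fun i _ => ?_
  have hi : (⟨x.1 i, hx i⟩ : LinearMap.ker φ) ∈ J • (⊤ : Submodule R (LinearMap.ker φ)) :=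
    by rw [h J hJ]; trivial
  rw [Submodule.mem_smul_top_iff] at hi
  have hi' := Submodule.mem_map_of_mem (f := (Finsupp.lsingle i : C →ₗ[R] (ι →₀ C))) hi
  rw [Submodule.map_smul''] at hi'
  refine Submodule.smul_mono le_rfl ?_ hi'
  rintro _ ⟨c, hc, rfl⟩
  have hc' : φ c = 0 := hc
  simp [hc']

/-- If `𝒜` is covering then a countable direct sum of copies of an `𝒜`-cover has only surjective
endomorphisms over its base. -/
theorem surjective_of_mapRange_comp_eq (hfg : G.FinitelyGenerated) (hA : G.IsACovering)
    {C M : Type u} [AddCommGroup C]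
    [Module R C] [AddCommGroup M] [Module R M] (hC : G.MemA C) (φ : C →ₗ[R] M)
    (hpre : ∀ (C' : Type u) [AddCommGroup C'] [Module R C'], G.MemA C' →
        ∀ f : C' →ₗ[R] M, ∃ g : C' →ₗ[R] C, φ ∘ₗ g = f)
    (hcov : ∀ e : C →ₗ[R] C, φ ∘ₗ e = φ → Function.Bijective e) (hφ : Function.Surjective φ)
    (g : (ℕ →₀ C) →ₗ[R] (ℕ →₀ C))
    (hg : Finsupp.mapRange.linearMap φ ∘ₗ g = Finsupp.mapRange.linearMap φ) :
    Function.Surjective g := by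
  set Φ : (ℕ →₀ C) →ₗ[R] (ℕ →₀ M) := Finsupp.mapRange.linearMap φ with hΦ
  have hΦs : Function.Surjective Φ := Finsupp.mapRange_surjective _ (map_zero φ) hφ
  have hΦk : G.IsDivisible (LinearMap.ker Φ) :=
    IsDivisible.ker_mapRange φ (isDivisible_ker_of_cover hfg hC φ hpre hcov) ℕ
  obtain ⟨X, ψ, hX, hXpre, hXcov⟩ := hA (ℕ →₀ M)
  obtain ⟨v, hv⟩ := hX.exists_lift Φ hΦs hΦk ψ
  obtain ⟨u, hu⟩ := hXpre _ (hC.finsupp ℕ) Φ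
  have hv' : ∀ x, Φ (v x) = ψ x := LinearMap.congr_fun hv
  have hu' : ∀ x, ψ (u x) = Φ x := LinearMap.congr_fun hu
  have hg' : ∀ x, Φ (g x) = Φ x := LinearMap.congr_fun hg
  obtain ⟨w, hwuv⟩ : ∃ w : X ≃ₗ[R] X, ∀ x, w x = u (v x) := ⟨LinearEquiv.ofBijective (u ∘ₗ v) (hXcov _ (LinearMap.ext fun x => by simp [hu', hv'])), fun _ => rfl⟩
  have hw : ∀ y, ψ (w.symm y) = ψ y := fun y => by
    conv_rhs => rw [← w.apply_symm_apply y]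
    rw [hwuv, hu', hv']
  have huinj : Function.Injective u := by
    rw [injective_iff_map_eq_zero]
    intro x hx
    let e : (ℕ →₀ C) →ₗ[R] (ℕ →₀ C) := LinearMap.id - v ∘ₗ w.symm.toLinearMap ∘ₗ u
    have hex : e x = x := by simp [e, hx]
    have hΦe : ∀ z, Φ (e z) = 0 := fun z => by simp [e, hv', hw, hu']
    have hall := LinearMap.eq_zero_of_eq_sum_of_comp_eq_zero φ hcov x.support x
      (fun i j => Finsupp.lapply i ∘ₗ e ∘ₗ Finsupp.lsingle j)
      (fun i j y => by simpa [hΦ] using DFunLike.congr_fun (hΦe (Finsupp.single j y)) i)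
      (fun i _ => by
        conv_lhs => rw [← hex, ← Finsupp.sum_single x]
        simp [Finsupp.sum, map_sum, Finsupp.finsetSum_apply])
    ext i
    by_contra hi
    exact hi (hall i (Finsupp.mem_support_iff.2 hi))
  intro b
  obtain ⟨c, hc⟩ := (hXcov (u ∘ₗ g ∘ₗ v)
    (LinearMap.ext fun x => by simp [hu', hg', hv'])).2 (u b)
  exact ⟨v c, huinj hc⟩

/-- If `𝒜` is covering and `J ∈ G`, then the `𝒜`-covers of modules killed by `J` are torsion. -/
theorem isTorsion_of_cover (hfg : G.FinitelyGenerated) (hA : G.IsACovering)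
    {C M : Type u} [AddCommGroup C]
    [Module R C] [AddCommGroup M] [Module R M] (hC : G.MemA C) (φ : C →ₗ[R] M)
    (hpre : ∀ (C' : Type u) [AddCommGroup C'] [Module R C'], G.MemA C' →
        ∀ f : C' →ₗ[R] M, ∃ g : C' →ₗ[R] C, φ ∘ₗ g = f)
    (hcov : ∀ e : C →ₗ[R] C, φ ∘ₗ e = φ → Function.Bijective e) (hφ : Function.Surjective φ)
    {J : Ideal R} (hJ : J ∈ G.sets) (hJM : ∀ r ∈ J, ∀ m : M, r • m = 0) : G.IsTorsion C := by
  intro x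
  by_contra hx
  have step : ∀ y : {y : C // Ideal.torsionOf R C y ∉ G.sets},
      ∃ r ∈ J, Ideal.torsionOf R C (r • y.1) ∉ G.sets := by
    rintro ⟨y, hy⟩
    by_contra! h
    refine hy (G.gabriel _ J hJ fun r hr => G.mem_of_le (h r hr) fun s hs => ?_)
    rw [Ideal.mem_torsionOf_iff] at hs
    rw [Ideal.mem_colon_span_singleton, Ideal.mem_torsionOf_iff, mul_smul, hs]
  choose r hrJ hr using step
  let y : ℕ → {y : C // Ideal.torsionOf R C y ∉ G.sets} :=
    fun n => Nat.rec ⟨x, hx⟩ (fun _ z => ⟨r z • z.1, hr z⟩) n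
  let t : (ℕ →₀ C) →ₗ[R] (ℕ →₀ C) :=
    Finsupp.lsum R fun n => r (y n) • Finsupp.lsingle (n + 1)
  have ht0 : ∀ b, t b 0 = 0 := fun b => by
    simp [t, Finsupp.sum, Finsupp.finsetSum_apply]
  have htS : ∀ b n, t b (n + 1) = r (y n) • b n := fun b n => by
    induction b using Finsupp.induction_linear with
    | zero => simp
    | add b c hb hc => simp [hb, hc]
    | single i c =>
      by_cases hi : i = n <;> simp [t, hi]
  obtain ⟨b, hb⟩ := surjective_of_mapRange_comp_eq hfg hA hC φ hpre hcov hφ (LinearMap.id - t)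
    (by
      ext i c n
      have hz : φ (r (y i) • c) = 0 := by rw [map_smul, hJM _ (hrJ _)]
      simp [t, Finsupp.single_apply, apply_ite φ, hz])
    (Finsupp.single 0 x)
  have hby : ∀ n, b n = (y n).1 := by
    intro n
    induction n with
    | zero => simpa [y, ht0] using DFunLike.congr_fun hb 0
    | succ n ih =>
      have hn := DFunLike.congr_fun hb (n + 1)
      rw [LinearMap.sub_apply, LinearMap.id_apply, Finsupp.sub_apply, htS, ih,
        Finsupp.single_eq_of_ne (by simp), sub_eq_zero] at hn
      exact hn
  obtain ⟨n, hn⟩ := Infinite.exists_notMem_finset b.support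
  have hyn : (y n).1 = 0 := by rw [← hby, Finsupp.notMem_support_iff.1 hn]
  refine (y n).2 ?_
  rw [hyn, Ideal.torsionOf_zero]
  exact G.top_mem

/-- A map from the kernel of `p : P → C`, with `C ∈ 𝒜`,
into a divisible module extends to `P`. -/
theorem MemA.exists_extend {C P D : Type u}
    [AddCommGroup C] [Module R C] [AddCommGroup P] [Module R P] [AddCommGroup D] [Module R D]
    (hC : G.MemA C) (p : P →ₗ[R] C) (hp : Function.Surjective p) (hD : G.IsDivisible D)
    (f : LinearMap.ker p →ₗ[R] D) :
    ∃ g : P →ₗ[R] D, ∀ x : LinearMap.ker p, g x = f x := by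
  obtain ⟨I, i, hI, hi⟩ := Module.exists_injective_embedding R D
  obtain ⟨h, hh⟩ := hI.out (LinearMap.ker p).subtype (Submodule.injective_subtype _) (i ∘ₗ f)
  let q := (LinearMap.range i).mkQ
  have hq : Function.Surjective q := Submodule.mkQ_surjective _
  have hqk : G.IsDivisible (LinearMap.ker q) := by
    rw [Submodule.ker_mkQ]
    exact hD.of_surjective i.rangeRestrict i.surjective_rangeRestrict
  have hle : LinearMap.ker p ≤ LinearMap.ker (q ∘ₗ h) := fun x hx => by
    have : h x = i (f ⟨x, hx⟩) := hh ⟨x, hx⟩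
    simp [q, this]
  let c : C →ₗ[R] (I ⧸ LinearMap.range i) :=
    (LinearMap.ker p).liftQ (q ∘ₗ h) hle ∘ₗ (p.quotKerEquivOfSurjective hp).symm.toLinearMap
  have hc : ∀ x, c (p x) = q (h x) := fun x => by
    have : (p.quotKerEquivOfSurjective hp).symm (p x) = Submodule.Quotient.mk x := by
      rw [LinearEquiv.symm_apply_eq]
      rfl
    simp only [c, LinearMap.comp_apply, LinearEquiv.coe_coe, this]
    rfl
  obtain ⟨k, hk⟩ := hC.exists_lift q hq hqk c
  have hmem : ∀ x, (h - k ∘ₗ p) x ∈ LinearMap.range i := fun x => by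
    rw [← Submodule.ker_mkQ (LinearMap.range i), LinearMap.mem_ker]
    have hkx : q (k (p x)) = c (p x) := LinearMap.congr_fun hk (p x)
    change q _ = 0
    rw [LinearMap.sub_apply, map_sub, LinearMap.comp_apply, hkx, hc, sub_self]
  refine ⟨(LinearEquiv.ofInjective i hi).symm.toLinearMap ∘ₗ
    LinearMap.codRestrict _ (h - k ∘ₗ p) hmem, fun x => ?_⟩
  rw [LinearMap.comp_apply, LinearEquiv.coe_coe, LinearEquiv.symm_apply_eq]
  refine Subtype.ext ?_
  have hx : p x = 0 := x.2
  have hhx : h x = i (f x) := hh x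
  simp [hx, hhx]

/-- Modules in `𝒜` have projective dimension at most one. -/
theorem MemA.projective_ker (hf : G.Faithful) (hfg : G.FinitelyGenerated) {C P : Type u}
    [AddCommGroup C] [Module R C] [AddCommGroup P] [Module R P] [Module.Projective R P]
    (hC : G.MemA C) (p : P →ₗ[R] C) (hp : Function.Surjective p) :
    Module.Projective R (LinearMap.ker p) := by
  refine Module.Projective.of_lifting_property'' fun π hπ => ?_
  obtain ⟨I, i, hI, hi⟩ := Module.exists_injective_embedding R (LinearMap.ker p →₀ R)
  let K := Submodule.map i (LinearMap.ker π)
  have hle : LinearMap.ker π ≤ LinearMap.ker (K.mkQ ∘ₗ i) := fun x hx => by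
    rw [LinearMap.mem_ker, LinearMap.comp_apply, Submodule.mkQ_apply,
      Submodule.Quotient.mk_eq_zero]
    exact Submodule.mem_map_of_mem hx
  have hdiv : G.IsDivisible (I ⧸ K) :=
    (hf.isDivisible_of_injective hfg I hI).of_surjective K.mkQ (Submodule.mkQ_surjective _)
  obtain ⟨g, hg⟩ := hC.exists_extend p hp hdiv
    ((LinearMap.ker π).liftQ (K.mkQ ∘ₗ i) hle ∘ₗ
      (π.quotKerEquivOfSurjective hπ).symm.toLinearMap)
  have hgπ : ∀ z, g (π z) = K.mkQ (i z) := fun z => by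
    have : (π.quotKerEquivOfSurjective hπ).symm (π z) = Submodule.Quotient.mk z := by
      rw [LinearEquiv.symm_apply_eq]
      rfl
    rw [hg, LinearMap.comp_apply, LinearEquiv.coe_coe, this]
    rfl
  obtain ⟨l, hl⟩ := Module.projective_lifting_property K.mkQ g (Submodule.mkQ_surjective _)
  have key : ∀ x : LinearMap.ker p, ∃ z, i z = l x ∧ π z = x := fun x => by
    obtain ⟨z, hz⟩ := hπ x
    have h1 : K.mkQ (l x - i z) = 0 := by
      have h2 : K.mkQ (l x) = g x := LinearMap.congr_fun hl x
      rw [map_sub, h2, ← hgπ z, hz, sub_self]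
    rw [Submodule.mkQ_apply, Submodule.Quotient.mk_eq_zero] at h1
    obtain ⟨w, hw, hwi⟩ := h1
    have hw' : π w = 0 := hw
    exact ⟨w + z, by rw [map_add, hwi, sub_add_cancel], by rw [map_add, hw', zero_add, hz]⟩
  let l' := LinearMap.codRestrict (LinearMap.range i) (l ∘ₗ (LinearMap.ker p).subtype)
    fun x => (key x).imp fun z hz => hz.1
  refine ⟨(LinearEquiv.ofInjective i hi).symm.toLinearMap ∘ₗ l', LinearMap.ext fun x => ?_⟩
  obtain ⟨z, hz, hzx⟩ := key x
  have : (LinearEquiv.ofInjective i hi).symm (l' x) = z := by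
    rw [LinearEquiv.symm_apply_eq]
    exact Subtype.ext hz.symm
  simp [this, hzx]

/-- Maps into the ring of quotients extend along inclusions with torsion cokernel. -/
theorem IsRingOfQuotients.exists_extend {Q : Type u} [CommRing Q] [Algebra R Q]
    (hQ : G.IsRingOfQuotients Q) {F : Type u} [AddCommGroup F] [Module R F] (P : Submodule R F)
    (hP : ∀ x : F, ∃ J ∈ G.sets, ∀ r ∈ J, r • x ∈ P) (f : P →ₗ[R] Q) :
    ∃ g : F →ₗ[R] Q, ∀ x : P, g x = f x := by
  obtain ⟨I, i, hI, hi⟩ := Module.exists_injective_embedding R Q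
  obtain ⟨h, hh⟩ := hI.out P.subtype (Submodule.injective_subtype _) (i ∘ₗ f)
  have hh' : ∀ x : F, ∀ hx : x ∈ P, h x = i (f ⟨x, hx⟩) := fun x hx => hh ⟨x, hx⟩
  have key : ∀ x : F, ∃ q : Q, ∃ J ∈ G.sets, ∀ r ∈ J, r • (h x - i q) = 0 := fun x => by
    obtain ⟨J, hJ, hJP⟩ := hP x
    let m : J →ₗ[R] Q := f ∘ₗ LinearMap.codRestrict P
      (LinearMap.toSpanSingleton R F x ∘ₗ J.subtype) fun r => hJP r r.2
    obtain ⟨q, hq⟩ := hQ.gInjective J hJ m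
    refine ⟨q, J, hJ, fun r hr => ?_⟩
    rw [smul_sub, ← map_smul, ← map_smul, hh' _ (hJP r hr), ← hq ⟨r, hr⟩]
    exact sub_self _
  have uniq : ∀ (y : I) (q q' : Q), (∃ J ∈ G.sets, ∀ r ∈ J, r • (y - i q) = 0) →
      (∃ J ∈ G.sets, ∀ r ∈ J, r • (y - i q') = 0) → q = q' := by
    rintro y q q' ⟨J, hJ, h1⟩ ⟨J', hJ', h2⟩
    rw [← sub_eq_zero]
    refine hQ.torsionFree _ (G.mem_of_le (G.inf_mem hJ hJ') fun r hr => ?_)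
    rw [Ideal.mem_torsionOf_iff]
    refine hi ?_
    have : i (r • (q - q')) = r • (y - i q') - r • (y - i q) := by
      rw [map_smul, map_sub, ← smul_sub, sub_sub_sub_cancel_left]
    rw [this, h1 r hr.1, h2 r hr.2, sub_zero, map_zero]
  choose g hg using key
  refine ⟨⟨⟨g, fun x y => ?_⟩, fun s x => ?_⟩, fun x => ?_⟩
  · obtain ⟨J, hJ, h1⟩ := hg x
    obtain ⟨J', hJ', h2⟩ := hg y
    refine uniq _ _ _ (hg _) ⟨J ⊓ J', G.inf_mem hJ hJ', fun r hr => ?_⟩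
    rw [map_add, map_add, add_sub_add_comm, smul_add, h1 r hr.1, h2 r hr.2, add_zero]
  · obtain ⟨J, hJ, h1⟩ := hg x
    refine uniq _ _ _ (hg _) ⟨J, hJ, fun r hr => ?_⟩
    rw [map_smul, RingHom.id_apply, map_smul, ← smul_sub, smul_comm, h1 r hr, smul_zero]
  · refine uniq _ _ _ (hg x) ⟨⊤, G.top_mem, fun r _ => ?_⟩
    rw [hh' x x.2, sub_self, smul_zero]

/-- If `J ∈ G` is finitely generated and `R/J` is a quotient of a torsion module in `𝒜`,
then `JQ = Q` for the ring of quotients `Q`. -/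
theorem IsRingOfQuotients.smul_top_eq_top {Q : Type u} [CommRing Q] [Algebra R Q]
    (hQ : G.IsRingOfQuotients Q) (hf : G.Faithful) (hfg : G.FinitelyGenerated) {n : ℕ}
    {a : Fin n → R} {J : Ideal R} (hJ : J = Ideal.span (Set.range a)) {C : Type u}
    [AddCommGroup C] [Module R C] (hC : G.MemA C) (hCt : G.IsTorsion C) (φ : C →ₗ[R] R ⧸ J)
    (hφ : Function.Surjective φ) : J • (⊤ : Submodule R Q) = ⊤ := by
  rw [eq_top_iff]
  rintro q -
  let B : Submodule R Q := J • ⊤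
  have hB : ∀ y, y ∈ B ↔ ∃ m : Fin n → Q, ∑ i, a i • m i = y := fun y => by
    simp only [B, hJ, Ideal.mem_span_range_smul_top_iff]
  let h : (R ⧸ J) →ₗ[R] (Q ⧸ B) :=
    Submodule.liftQ J (B.mkQ ∘ₗ LinearMap.toSpanSingleton R Q q) fun r hr => by
      rw [LinearMap.mem_ker, LinearMap.comp_apply, Submodule.mkQ_apply,
        Submodule.Quotient.mk_eq_zero]
      exact Submodule.smul_mem_smul hr trivial
  let p : (C →₀ R) →ₗ[R] C := Finsupp.linearCombination R id
  have hp : Function.Surjective p := Finsupp.linearCombination_id_surjective R C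
  obtain ⟨b, hb⟩ := Module.projective_lifting_property B.mkQ (h ∘ₗ φ ∘ₗ p)
    (Submodule.mkQ_surjective _)
  have hb' : ∀ x, B.mkQ (b x) = h (φ (p x)) := LinearMap.congr_fun hb
  have hbB : ∀ x : LinearMap.ker p, b x ∈ B := fun x => by
    have hx : p x = 0 := x.2
    rw [← Submodule.Quotient.mk_eq_zero, ← Submodule.mkQ_apply, hb', hx, map_zero, map_zero]
  let π : (Fin n → Q) →ₗ[R] Q := ∑ i, a i • LinearMap.proj i
  have hπ : ∀ m, π m = ∑ i, a i • m i := fun m => by simp [π]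
  have hπB : ∀ m, π m ∈ B := fun m =>
    (hB _).2 ⟨m, (hπ m).symm⟩
  let π' : (Fin n → Q) →ₗ[R] B := LinearMap.codRestrict B π hπB
  have hπ' : Function.Surjective π' := fun x => by
    obtain ⟨m, hm⟩ := (hB _).1 x.2
    exact ⟨m, Subtype.ext ((hπ m).trans hm)⟩
  have := hC.projective_ker hf hfg p hp
  obtain ⟨c, hc⟩ := Module.projective_lifting_property π'
    (LinearMap.codRestrict B (b ∘ₗ (LinearMap.ker p).subtype) hbB) hπ'
  have hc' : ∀ x, π (c x) = b x := fun x => congrArg Subtype.val (LinearMap.congr_fun hc x)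
  have htors : ∀ x, ∃ J ∈ G.sets, ∀ r ∈ J, r • x ∈ LinearMap.ker p := fun x =>
    ⟨_, hCt (p x), fun r hr => by
      rw [LinearMap.mem_ker, map_smul]
      exact (Ideal.mem_torsionOf_iff _ _).1 hr⟩
  choose d hd using fun i => hQ.exists_extend (LinearMap.ker p) htors (LinearMap.proj i ∘ₗ c)
  have hbd : ∀ x, b x = π (LinearMap.pi d x) := fun x => by
    rw [← sub_eq_zero]
    obtain ⟨J', hJ', hx⟩ := htors x
    refine hQ.torsionFree _ (G.mem_of_le hJ' fun r hr => ?_)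
    rw [Ideal.mem_torsionOf_iff, smul_sub, ← map_smul, ← map_smul, ← map_smul,
      ← hc' ⟨r • x, hx r hr⟩, sub_eq_zero]
    congr 1
    ext i
    exact (hd i ⟨r • x, hx r hr⟩).symm
  obtain ⟨y, hy⟩ := hφ (Submodule.Quotient.mk 1)
  obtain ⟨x, rfl⟩ := hp y
  have h1 : B.mkQ q = B.mkQ (b x) := by
    rw [hb', hy]
    exact congrArg B.mkQ (one_smul R q).symm
  rw [hbd, Submodule.mkQ_apply B (π _), (Submodule.Quotient.mk_eq_zero B).2 (hπB _),
    Submodule.mkQ_apply, Submodule.Quotient.mk_eq_zero] at h1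
  exact h1

theorem smul_top_eq_top_of_isACovering {Q : Type u} [CommRing Q] [Algebra R Q]
    (hQ : G.IsRingOfQuotients Q) (hf : G.Faithful) (hfg : G.FinitelyGenerated)
    (hA : G.IsACovering) {n : ℕ} (a : Fin n → R) (ha : Ideal.span (Set.range a) ∈ G.sets) :
    Ideal.span (Set.range a) • (⊤ : Submodule R Q) = ⊤ := by
  obtain ⟨C, φ, hC, hpre, hcov⟩ := hA (R ⧸ Ideal.span (Set.range a))
  have hφ : Function.Surjective φ := by
    obtain ⟨g, hg⟩ := hpre R (memA_of_projective R) (Submodule.mkQ _)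
    refine fun y => (Submodule.mkQ_surjective _ y).imp' g fun r hr => ?_
    rw [← hr, ← hg, LinearMap.comp_apply]
  refine hQ.smul_top_eq_top hf hfg rfl hC
    (isTorsion_of_cover hfg hA hC φ hpre hcov hφ ha fun r hr m => ?_) φ hφ
  obtain ⟨m, rfl⟩ := Submodule.Quotient.mk_surjective _ m
  rw [← Submodule.Quotient.mk_smul, Submodule.Quotient.mk_eq_zero]
  exact Ideal.mul_mem_right m _ hr

/-- A finite set of elements of the ring of quotients has a common denominator ideal. -/
theorem IsRingOfQuotients.exists_common_denominator {Q : Type u} [CommRing Q] [Algebra R Q]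
    (hQ : G.IsRingOfQuotients Q) {l : ℕ} (x : Fin l → Q) :
    ∃ J ∈ G.sets, ∀ r ∈ J, ∀ i, ∃ s : R, r • x i = algebraMap R Q s := by
  induction l with
  | zero => exact ⟨⊤, G.top_mem, fun _ _ i => i.elim0⟩
  | succ l ih =>
    obtain ⟨J, hJ, h1⟩ := ih fun i => x i.succ
    obtain ⟨J', hJ', h2⟩ := hQ.coker_torsion (x 0)
    exact ⟨J ⊓ J', G.inf_mem hJ hJ', fun r hr => Fin.cases (h2 r hr.2) (h1 r hr.1)⟩

/-- If the ring of quotients is `G`-divisible then `G` is perfect. -/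
theorem IsRingOfQuotients.isPerfectLocalization {Q : Type u} [CommRing Q] [Algebra R Q]
    (hQ : G.IsRingOfQuotients Q) (hf : G.Faithful) (hfg : G.FinitelyGenerated)
    (hdiv : G.IsDivisible Q) : G.IsPerfectLocalization Q := by
  have hinj : ∀ r : R, algebraMap R Q r = 0 → r = 0 := fun r hr => hf r (hQ.ker_torsion r hr)
  have hone : ∀ J ∈ G.sets, ∃ (n : ℕ) (a : Fin n → R) (p : Fin n → Q),
      (∀ i, a i ∈ J) ∧ ∑ i, a i • p i = 1 := fun J hJ => by
    obtain ⟨J', hJ', hle, hJfg⟩ := hfg J hJ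
    obtain ⟨n, a, rfl⟩ := Submodule.fg_iff_exists_fin_generating_family.1 hJfg
    obtain ⟨p, hp⟩ := hdiv.exists_sum_eq hJ' (1 : Q)
    exact ⟨n, a, p, fun i => hle (Ideal.subset_span ⟨i, rfl⟩), hp⟩
  refine ⟨Module.Flat.of_forall_isTrivialRelation fun {l f x} hfx => ?_,
    fun S _ f g hfg' => ?_, fun J => ⟨hdiv J, fun hJ => ?_⟩⟩
  · obtain ⟨J, hJ, hden⟩ := hQ.exists_common_denominator x
    obtain ⟨n, a, p, haJ, hp⟩ := hone J hJ
    choose s hs using fun i j => hden (a j) (haJ j) i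
    refine ⟨n, s, p, fun i => ?_, fun j => hinj _ ?_⟩
    · conv_lhs => rw [← mul_one (x i), ← hp, Finset.mul_sum]
      refine Finset.sum_congr rfl fun j _ => ?_
      rw [Algebra.smul_def (s i j), ← hs, mul_smul_comm, smul_mul_assoc]
    · simp_rw [map_sum, map_mul, ← hs, ← Algebra.smul_def, smul_comm _ (a j), ← Finset.smul_sum,
        hfx, smul_zero]
  · ext q
    obtain ⟨J, hJ, hden⟩ := hQ.coker_torsion q
    obtain ⟨n, a, p, haJ, hp⟩ := hone J hJ
    have hR : ∀ r : R, f (algebraMap R Q r) = g (algebraMap R Q r) := RingHom.congr_fun hfg'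
    have hterm : ∀ i, f (a i • p i) * f q = f (a i • p i) * g q := fun i => by
      obtain ⟨s, hs⟩ := hden (a i) (haJ i)
      rw [Algebra.smul_def] at hs ⊢
      calc f (algebraMap R Q (a i) * p i) * f q = f (p i) * f (algebraMap R Q (a i) * q) := by
            simp only [map_mul]; ring
        _ = f (p i) * g (algebraMap R Q (a i) * q) := by rw [hs, hR]
        _ = f (algebraMap R Q (a i) * p i) * g q := by
            simp only [map_mul, hR]; ring
    have hsum : f (∑ i, a i • p i) * f q = f (∑ i, a i • p i) * g q := by
      simp_rw [map_sum, Finset.sum_mul, hterm]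
    simpa [hp] using hsum
  · have h1 : (1 : Q) ∈ J • (⊤ : Submodule R Q) := by rw [hJ]; trivial
    have key : ∀ q ∈ J • (⊤ : Submodule R Q),
        ∃ I ∈ G.sets, ∀ r ∈ I, ∃ s ∈ J, r • q = algebraMap R Q s := fun q hq => by
      refine Submodule.smul_induction_on hq (fun j hj y _ => ?_) ?_
      · obtain ⟨I, hI, h⟩ := hQ.coker_torsion y
        refine ⟨I, hI, fun r hr => ?_⟩
        obtain ⟨s, hs⟩ := h r hr
        exact ⟨j * s, J.mul_mem_right s hj, by
          rw [smul_comm, hs, map_mul, Algebra.smul_def]⟩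
      · rintro y z ⟨I, hI, h⟩ ⟨I', hI', h'⟩
        refine ⟨I ⊓ I', G.inf_mem hI hI', fun r hr => ?_⟩
        obtain ⟨s, hsJ, hs⟩ := h r hr.1
        obtain ⟨s', hsJ', hs'⟩ := h' r hr.2
        exact ⟨s + s', J.add_mem hsJ hsJ', by rw [smul_add, hs, hs', map_add]⟩
    obtain ⟨I, hI, h⟩ := key 1 h1
    refine G.mem_of_le hI fun r hr => ?_
    obtain ⟨s, hs, hrs⟩ := h r hr
    rw [← Algebra.algebraMap_eq_smul_one, ← sub_eq_zero, ← map_sub] at hrs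
    rwa [sub_eq_zero.1 (hinj _ hrs)]

end GabrielTopology

theorem stmt6 (R : Type u) [CommRing R] (G : GabrielTopology R)
    (hG : G.IsTiltingTopology) (hcov : G.IsACovering) :
    ∀ (Q : Type u) [CommRing Q] [Algebra R Q], G.IsRingOfQuotients Q →
      G.IsPerfectLocalization Q := by
  intro Q _ _ hQ
  obtain ⟨hf, hfg, -⟩ := hG
  refine hQ.isPerfectLocalization hf hfg
    (GabrielTopology.isDivisible_of_forall_fin hfg fun n a ha x => ?_)
  rw [← Ideal.mem_span_range_smul_top_iff,
    GabrielTopology.smul_top_eq_top_of_isACovering hQ hf hfg hcov a ha]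
  trivial
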